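/- Let q ≥ 1 and let r be an integer with 0 ≤ r < 2^q and r ≠ 2^q − 1; set j = 2^q + r and d = 2^{q+1} + r − 1. If the ideal A_j of R is contained in the ideal B_d of R, then A_{j+1} is contained in B_{d+1}. -/

import Mathlib

open MvPolynomial

noncomputable section

/-- The relations `2Y, 2M, 4W, M² − W·Y` in `ℤ[Y,M,W]` (with `Y = X 0`, `M = X 1`, `W = X 2`). -/
def relIdeal : Ideal (MvPolynomial (Fin 3) ℤ) :=
  Ideal.span {2 * X 0, 2 * X 1, 4 * X 2, X 1 ^ 2 - X 2 * X 0}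

/-- The ring `R = ℤ[Y,M,W]/⟨2Y, 2M, 4W, M² − W·Y⟩`. -/
abbrev Rring : Type := MvPolynomial (Fin 3) ℤ ⧸ relIdeal

/-- The image of `Y` in `R`. -/
def Yv : Rring := Ideal.Quotient.mk relIdeal (X 0)

/-- The image of `M` in `R`. -/
def Mv : Rring := Ideal.Quotient.mk relIdeal (X 1)

/-- The image of `W` in `R`. -/
def Wv : Rring := Ideal.Quotient.mk relIdeal (X 2)

/-- `Π_d = Σ_{0 ≤ 2i ≤ d−1} (C(d−1−i, i) mod 2)·W^i·Y^{d−2i} ∈ R`,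
the binomial coefficients being taken mod 2 as elements 0 or 1 of ℤ. -/
def PiR (d : ℕ) : Rring :=
  ∑ i ∈ Finset.range (d + 1),
    if 2 * i + 1 ≤ d then
      ((((d - 1 - i).choose i % 2 : ℕ) : Rring)) * Wv ^ i * Yv ^ (d - 2 * i)
    else 0

/-- The ideal `A_j ⊆ R`. -/
def AIdeal (j : ℕ) : Ideal Rring :=
  if j % 2 = 0 then Ideal.span {Yv ^ (j / 2) * Wv ^ (j / 2)}
  else
    Ideal.span {Yv ^ ((j + 1) / 2) * Wv ^ ((j - 1) / 2) * Mv,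
      Yv ^ ((j + 1) / 2) * Wv ^ ((j + 1) / 2)}

/-- The ideal `B_d ⊆ R`. -/
def BIdeal (d : ℕ) : Ideal Rring :=
  if d % 2 = 0 then
    Ideal.span {PiR ((d + 2) / 2), PiR ((d + 4) / 2), Mv * PiR (d / 2)}
  else Ideal.span {PiR ((d + 1) / 2), PiR ((d + 3) / 2)}

theorem two_mul_Yv : 2 * Yv = 0 := by
  have h : Ideal.Quotient.mk relIdeal (2 * X 0) = 0 :=
    Ideal.Quotient.eq_zero_iff_mem.2 (Ideal.subset_span (by simp))
  exact h

theorem two_mul_Mv : 2 * Mv = 0 := by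
  have h : Ideal.Quotient.mk relIdeal (2 * X 1) = 0 :=
    Ideal.Quotient.eq_zero_iff_mem.2 (Ideal.subset_span (by simp))
  exact h

theorem four_mul_Wv : 4 * Wv = 0 := by
  have h : Ideal.Quotient.mk relIdeal (4 * X 2) = 0 :=
    Ideal.Quotient.eq_zero_iff_mem.2 (Ideal.subset_span (by simp))
  exact h

theorem Mv_sq : Mv ^ 2 = Wv * Yv := by
  have h : Ideal.Quotient.mk relIdeal (X 1 ^ 2 - X 2 * X 0) = 0 :=
    Ideal.Quotient.eq_zero_iff_mem.2 (Ideal.subset_span (by simp))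
  simpa [Mv, Wv, Yv, sub_eq_zero] using h

theorem natCast_mod_two_mul_Yv (c : ℕ) : ((c % 2 : ℕ) : Rring) * Yv = c * Yv := by
  conv_rhs => rw [← Nat.mod_add_div c 2]
  push_cast
  linear_combination (-((c / 2 : ℕ) : Rring)) * two_mul_Yv

/-- The summand of `PiR d` of index `i`. -/
def piTerm (d i : ℕ) : Rring :=
  if 2 * i + 1 ≤ d then
    ((((d - 1 - i).choose i % 2 : ℕ) : Rring)) * Wv ^ i * Yv ^ (d - 2 * i)
  else 0

theorem piTerm_of_lt {d i : ℕ} (h : d < 2 * i + 1) : piTerm d i = 0 :=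
  if_neg (by omega)

theorem piTerm_two_mul_add (i k : ℕ) :
    piTerm (2 * i + k + 1) i = ((i + k).choose i : Rring) * Wv ^ i * Yv ^ (k + 1) := by
  rw [piTerm, if_pos (by omega), show 2 * i + k + 1 - 1 - i = i + k by omega,
    show 2 * i + k + 1 - 2 * i = k + 1 by omega, pow_succ]
  linear_combination Wv ^ i * Yv ^ k * natCast_mod_two_mul_Yv ((i + k).choose i)

theorem piTerm_zero_right (d : ℕ) : piTerm (d + 1) 0 = Yv ^ (d + 1) := by
  simpa using piTerm_two_mul_add 0 d

theorem piTerm_add_two_succ (d i : ℕ) :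
    piTerm (d + 2) (i + 1) = Yv * piTerm (d + 1) (i + 1) + Wv * piTerm d i := by
  rcases lt_or_ge d (2 * i + 1) with h | h
  · rw [piTerm_of_lt (by omega), piTerm_of_lt (by omega), piTerm_of_lt h]
    ring
  obtain ⟨k, rfl⟩ : ∃ k, d = 2 * i + k + 1 := ⟨d - (2 * i + 1), by omega⟩
  rw [show 2 * i + k + 1 + 2 = 2 * (i + 1) + k + 1 by ring, piTerm_two_mul_add,
    piTerm_two_mul_add]
  rcases k with _ | k
  · rw [piTerm_of_lt (by omega)]
    simp only [add_zero, Nat.choose_self]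
    ring
  · rw [show 2 * i + (k + 1) + 1 + 1 = 2 * (i + 1) + k + 1 by ring, piTerm_two_mul_add,
      show i + 1 + (k + 1) = (i + 1 + k) + 1 by ring, Nat.choose_succ_succ,
      show i + (k + 1) = i + 1 + k by ring]
    push_cast
    ring

theorem PiR_eq_sum (d : ℕ) {n : ℕ} (h : d < n) :
    PiR d = ∑ i ∈ Finset.range n, piTerm d i :=
  Finset.sum_subset (Finset.range_mono h)
    fun i _ hi ↦ piTerm_of_lt (by rw [Finset.mem_range] at hi; omega)

theorem PiR_add_two (d : ℕ) : PiR (d + 2) = Yv * PiR (d + 1) + Wv * PiR d := by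
  rw [PiR_eq_sum (d + 2) (n := d + 3) (by omega), PiR_eq_sum (d + 1) (n := d + 3) (by omega),
    PiR_eq_sum d (n := d + 2) (by omega), Finset.sum_range_succ',
    Finset.sum_range_succ' (piTerm (d + 1)), piTerm_zero_right (d + 1), piTerm_zero_right d]
  simp only [piTerm_add_two_succ, Finset.sum_add_distrib, ← Finset.mul_sum]
  ring

/-- The ring homomorphism `ℤ[Y,M,W] → R[ℤ/2]` recording the parity of the exponent of `M`. -/
def polyGradingHom : MvPolynomial (Fin 3) ℤ →+* AddMonoidAlgebra Rring (ZMod 2) :=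
  eval₂Hom (Int.castRingHom _) ![(AddMonoidAlgebra.single 0 Yv : AddMonoidAlgebra Rring (ZMod 2)),
    AddMonoidAlgebra.single 1 Mv, AddMonoidAlgebra.single 0 Wv]

theorem relIdeal_le_ker_polyGradingHom : relIdeal ≤ RingHom.ker polyGradingHom := by
  have h2 : (2 : AddMonoidAlgebra Rring (ZMod 2)) = AddMonoidAlgebra.single 0 2 :=
    (map_ofNat AddMonoidAlgebra.singleZeroRingHom 2).symm
  have h4 : (4 : AddMonoidAlgebra Rring (ZMod 2)) = AddMonoidAlgebra.single 0 4 :=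
    (map_ofNat AddMonoidAlgebra.singleZeroRingHom 4).symm
  have h11 : (1 + 1 : ZMod 2) = 0 := rfl
  refine Ideal.span_le.2 ?_
  rintro x (rfl | rfl | rfl | rfl) <;>
    rw [SetLike.mem_coe, RingHom.mem_ker]
  · simp [polyGradingHom, h2, AddMonoidAlgebra.single_mul_single, two_mul_Yv]
  · simp [polyGradingHom, h2, AddMonoidAlgebra.single_mul_single, two_mul_Mv]
  · simp [polyGradingHom, h4, AddMonoidAlgebra.single_mul_single, four_mul_Wv]
  · rw [map_sub, map_pow, map_mul]
    simp [polyGradingHom, pow_two, AddMonoidAlgebra.single_mul_single, h11, ← Mv_sq]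

/-- The coaction `R → R[ℤ/2]` of the grading in which `M` is odd and `Y`, `W` are even. -/
def gradingHom : Rring →+* AddMonoidAlgebra Rring (ZMod 2) :=
  Ideal.Quotient.lift relIdeal polyGradingHom fun _ ha ↦ relIdeal_le_ker_polyGradingHom ha

theorem gradingHom_Yv : gradingHom Yv = AddMonoidAlgebra.single 0 Yv := by
  simp [gradingHom, polyGradingHom, Yv]

theorem gradingHom_Mv : gradingHom Mv = AddMonoidAlgebra.single 1 Mv := by
  simp [gradingHom, polyGradingHom, Mv]

theorem gradingHom_Wv : gradingHom Wv = AddMonoidAlgebra.single 0 Wv := by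
  simp [gradingHom, polyGradingHom, Wv]

/-- The subring of even elements of `R`. -/
def evenSubring : Subring Rring :=
  gradingHom.eqLocus AddMonoidAlgebra.singleZeroRingHom

theorem gradingHom_of_mem {x : Rring} (h : x ∈ evenSubring) :
    gradingHom x = AddMonoidAlgebra.single 0 x := h

theorem Yv_mem_evenSubring : Yv ∈ evenSubring := gradingHom_Yv

theorem Wv_mem_evenSubring : Wv ∈ evenSubring := gradingHom_Wv

theorem PiR_mem_evenSubring (d : ℕ) : PiR d ∈ evenSubring := by
  refine sum_mem fun i _ ↦ ?_
  split_ifs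
  · exact mul_mem (mul_mem (natCast_mem _ _) (pow_mem Wv_mem_evenSubring _))
      (pow_mem Yv_mem_evenSubring _)
  · exact zero_mem _

theorem exists_even_add_Mv_mul_even (x : Rring) :
    ∃ a ∈ evenSubring, ∃ b ∈ evenSubring, x = a + Mv * b := by
  obtain ⟨p, rfl⟩ := Ideal.Quotient.mk_surjective x
  induction p using MvPolynomial.induction_on with
  | C n => exact ⟨n, intCast_mem _ _, 0, zero_mem _, by simp⟩
  | add p q hp hq =>
    obtain ⟨a, ha, b, hb, hp⟩ := hp
    obtain ⟨a', ha', b', hb', hq⟩ := hq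
    exact ⟨a + a', add_mem ha ha', b + b', add_mem hb hb', by rw [map_add, hp, hq]; ring⟩
  | mul_X p i hp =>
    obtain ⟨a, ha, b, hb, hp⟩ := hp
    rw [map_mul, hp]
    fin_cases i
    · exact ⟨a * Yv, mul_mem ha Yv_mem_evenSubring, b * Yv, mul_mem hb Yv_mem_evenSubring, by
        change (a + Mv * b) * Yv = _
        ring⟩
    · exact ⟨Wv * Yv * b, mul_mem (mul_mem Wv_mem_evenSubring Yv_mem_evenSubring) hb, a, ha, by
        change (a + Mv * b) * Mv = _
        linear_combination b * Mv_sq⟩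
    · exact ⟨a * Wv, mul_mem ha Wv_mem_evenSubring, b * Wv, mul_mem hb Wv_mem_evenSubring, by
        change (a + Mv * b) * Wv = _
        ring⟩

theorem eq_of_eq_add_Mv_mul {x a b : Rring} (hx : x ∈ evenSubring) (ha : a ∈ evenSubring)
    (hb : b ∈ evenSubring) (h : x = a + Mv * b) : x = a := by
  have h' := congrArg gradingHom h
  rw [map_add, map_mul, gradingHom_of_mem hx, gradingHom_of_mem ha, gradingHom_of_mem hb,
    gradingHom_Mv, AddMonoidAlgebra.single_mul_single] at h'
  simpa [Finsupp.single_apply] using congrArg (fun f ↦ f.coeff 0) h'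

theorem mem_span_PiR_of_even {x : Rring} {n : ℕ} (hx : x ∈ evenSubring)
    (h : x ∈ Ideal.span {PiR (n + 1), PiR (n + 2), Mv * PiR n}) :
    x ∈ Ideal.span {PiR (n + 1), PiR (n + 2)} := by
  obtain ⟨u, y, hy, rfl⟩ := Ideal.mem_span_insert.1 h
  obtain ⟨v, w, rfl⟩ := Ideal.mem_span_pair.1 hy
  obtain ⟨u₀, hu₀, u₁, hu₁, rfl⟩ := exists_even_add_Mv_mul_even u
  obtain ⟨v₀, hv₀, v₁, hv₁, rfl⟩ := exists_even_add_Mv_mul_even v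
  obtain ⟨w₀, hw₀, w₁, hw₁, rfl⟩ := exists_even_add_Mv_mul_even w
  have hP := PiR_mem_evenSubring
  rw [eq_of_eq_add_Mv_mul (a := u₀ * PiR (n + 1) + v₀ * PiR (n + 2) + Wv * Yv * w₁ * PiR n)
    (b := u₁ * PiR (n + 1) + v₁ * PiR (n + 2) + w₀ * PiR n) hx
    (add_mem (add_mem (mul_mem hu₀ (hP _)) (mul_mem hv₀ (hP _)))
      (mul_mem (mul_mem (mul_mem Wv_mem_evenSubring Yv_mem_evenSubring) hw₁) (hP _)))
    (add_mem (add_mem (mul_mem hu₁ (hP _)) (mul_mem hv₁ (hP _))) (mul_mem hw₀ (hP _)))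
    (by linear_combination w₁ * PiR n * Mv_sq)]
  exact Ideal.mem_span_pair.2 ⟨u₀ - Yv * Yv * w₁, v₀ + Yv * w₁, by
    linear_combination Yv * w₁ * PiR_add_two n⟩

theorem AIdeal_two_mul (k : ℕ) : AIdeal (2 * k) = Ideal.span {Yv ^ k * Wv ^ k} := by
  rw [AIdeal, if_pos (by omega), show 2 * k / 2 = k by omega]

theorem AIdeal_two_mul_add_one (k : ℕ) :
    AIdeal (2 * k + 1) =
      Ideal.span {Yv ^ (k + 1) * Wv ^ k * Mv, Yv ^ (k + 1) * Wv ^ (k + 1)} := by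
  rw [AIdeal, if_neg (by omega), show (2 * k + 1 + 1) / 2 = k + 1 by omega,
    show (2 * k + 1 - 1) / 2 = k by omega]

theorem BIdeal_two_mul (n : ℕ) :
    BIdeal (2 * n) = Ideal.span {PiR (n + 1), PiR (n + 2), Mv * PiR n} := by
  rw [BIdeal, if_pos (by omega), show (2 * n + 2) / 2 = n + 1 by omega,
    show (2 * n + 4) / 2 = n + 2 by omega, show 2 * n / 2 = n by omega]

theorem BIdeal_two_mul_add_one (n : ℕ) :
    BIdeal (2 * n + 1) = Ideal.span {PiR (n + 1), PiR (n + 2)} := by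
  rw [BIdeal, if_neg (by omega), show (2 * n + 1 + 1) / 2 = n + 1 by omega,
    show (2 * n + 1 + 3) / 2 = n + 2 by omega]

theorem AIdeal_le_BIdeal_of_odd {k n : ℕ} (h : AIdeal (2 * k + 1) ≤ BIdeal (2 * n)) :
    AIdeal (2 * k + 2) ≤ BIdeal (2 * n + 1) := by
  rw [AIdeal_two_mul_add_one, BIdeal_two_mul] at h
  rw [show 2 * k + 2 = 2 * (k + 1) by ring, AIdeal_two_mul, BIdeal_two_mul_add_one,
    Ideal.span_singleton_le_iff_mem]
  exact mem_span_PiR_of_even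
    (mul_mem (pow_mem Yv_mem_evenSubring _) (pow_mem Wv_mem_evenSubring _))
    (h (Ideal.subset_span (by simp)))

theorem AIdeal_le_BIdeal_of_even {k n : ℕ} (h : AIdeal (2 * k) ≤ BIdeal (2 * n + 1)) :
    AIdeal (2 * k + 1) ≤ BIdeal (2 * n + 2) := by
  rw [AIdeal_two_mul, BIdeal_two_mul_add_one, Ideal.span_singleton_le_iff_mem] at h
  obtain ⟨u, v, huv⟩ := Ideal.mem_span_pair.1 h
  rw [AIdeal_two_mul_add_one, show 2 * n + 2 = 2 * (n + 1) by ring, BIdeal_two_mul]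
  refine Ideal.span_le.2 ?_
  rintro x (rfl | rfl)
  · refine Ideal.mem_span_insert.2 ⟨Yv * Mv * v, _, Ideal.mem_span_pair.2 ⟨0, Yv * u, rfl⟩, ?_⟩
    linear_combination (-Yv * Mv) * huv
  · refine Ideal.mem_span_insert.2 ⟨Yv * Wv * v - Yv * Yv * u, _,
      Ideal.mem_span_pair.2 ⟨Yv * u, 0, rfl⟩, ?_⟩
    linear_combination (-Yv * Wv) * huv - Yv * u * PiR_add_two (n + 1)

/-- Let `q ≥ 1` and `0 ≤ r < 2^q` with `r ≠ 2^q − 1`; set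
`j = 2^q + r` and `d = 2^{q+1} + r − 1`. If `A_j ⊆ B_d` then `A_{j+1} ⊆ B_{d+1}`. -/
theorem statement10 (q r j d : ℕ) (hq : 1 ≤ q) (hr : r < 2 ^ q) (hr' : r ≠ 2 ^ q - 1)
    (hj : j = 2 ^ q + r) (hd : d = 2 ^ (q + 1) + r - 1)
    (h : AIdeal j ≤ BIdeal d) : AIdeal (j + 1) ≤ BIdeal (d + 1) := by
  have hpow : 2 ^ (q + 1) = 2 * 2 ^ q := pow_succ' 2 q
  obtain ⟨s, hs⟩ : ∃ s, 2 ^ q = 2 * s := ⟨2 ^ (q - 1), by rw [← pow_succ', Nat.sub_add_cancel hq]⟩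
  obtain ⟨t, rfl | rfl⟩ := r.even_or_odd'
  · obtain rfl : j = 2 * (s + t) := by omega
    obtain rfl : d = 2 * (2 * s + t - 1) + 1 := by omega
    exact AIdeal_le_BIdeal_of_even h
  · obtain rfl : j = 2 * (s + t) + 1 := by omega
    obtain rfl : d = 2 * (2 * s + t) := by omega
    exact AIdeal_le_BIdeal_of_odd h

end
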